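/- arXiv:2301.07423 — 2 statements merged into one kernel-verified Lean document; each statement's English description precedes it below -/
import Mathlib

section
/- The set D' := {σ ∈ Aut(F'/K) : there exist nonzero λ, μ, ρ ∈ K with σ(x) = λx, σ(y) = μy, σ(z) = ρz} is a cyclic subgroup of Aut(F'/K) of order (q+1)·(q̄−1)·(m/s). Moreover, for σ ∈ D' with σ(x) = λx, σ(y) = μy, σ(z) = ρz one necessarily has μ^{q^2} = μ, λ = μ^{q+1}, λ^{q̄} = λ, and ρ^{m/s} = μ. -/
open MvPolynomial

/-- The defining ideal of the curve `X_{a,b,n,s}` : it is generated by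
`Z^(m/s) - (Y^(q^2) - Y)` and `c·Y^(q+1) - Tr(X)` in `K[X,Y,Z]`, where
`Tr(X) = X + X^q̄ + X^(q̄^2) + ⋯ + X^(q/q̄)` is the trace polynomial with `e = a/b`
terms (variables `X 0 = X`, `X 1 = Y`, `X 2 = Z`, `t` stands for `m/s`, `qb` for `q̄`). -/
noncomputable def XIdeal (K : Type) [Field K] (c : K) (q qb t e : ℕ) :
    Ideal (MvPolynomial (Fin 3) K) :=
  Ideal.span {X 2 ^ t - (X 1 ^ (q ^ 2) - X 1),
    C c * X 1 ^ (q + 1) - ∑ i ∈ Finset.range e, X 0 ^ qb ^ i}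

/-- The coordinate ring `K[X,Y,Z]/I'` of the curve `X_{a,b,n,s}`. -/
noncomputable abbrev XRing (K : Type) [Field K] (c : K) (q qb t e : ℕ) :=
  MvPolynomial (Fin 3) K ⧸ XIdeal K c q qb t e

/-- The function field `F' = Frac(K[X,Y,Z]/I')` of the curve `X_{a,b,n,s}`. -/
noncomputable abbrev XField (K : Type) [Field K] (c : K) (q qb t e : ℕ) :=
  FractionRing (XRing K c q qb t e)

/-- The coordinate function `x ∈ F'`, image of the variable `X`. -/
noncomputable def Xx (K : Type) [Field K] (c : K) (q qb t e : ℕ) : XField K c q qb t e :=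
  algebraMap (XRing K c q qb t e) (XField K c q qb t e) (Ideal.Quotient.mk _ (X 0))

/-- The coordinate function `y ∈ F'`, image of the variable `Y`. -/
noncomputable def Xy (K : Type) [Field K] (c : K) (q qb t e : ℕ) : XField K c q qb t e :=
  algebraMap (XRing K c q qb t e) (XField K c q qb t e) (Ideal.Quotient.mk _ (X 1))

/-- The coordinate function `z ∈ F'`, image of the variable `Z`. -/
noncomputable def Xz (K : Type) [Field K] (c : K) (q qb t e : ℕ) : XField K c q qb t e :=
  algebraMap (XRing K c q qb t e) (XField K c q qb t e) (Ideal.Quotient.mk _ (X 2))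


/-- Coefficients of an additive-type polynomial. -/
lemma aux_coeff {K : Type} [Field K] (qb e : ℕ) (hqb : 2 ≤ qb) (f : ℕ → K) (j : ℕ) (hj : j < e) :
    (∑ i ∈ Finset.range e, Polynomial.C (f i) * Polynomial.X ^ qb ^ i).coeff (qb ^ j) = f j := by
  rw [Polynomial.finsetSum_coeff, Finset.sum_eq_single j]
  · simp
  · intro i _ hij
    rw [Polynomial.coeff_C_mul_X_pow, if_neg]
    intro h
    exact hij ((Nat.pow_right_injective hqb h).symm)
  · intro h
    exact absurd (Finset.mem_range.2 hj) h

lemma aux_coeff_eq {K : Type} [Field K] [Infinite K] (qb e : ℕ) (hqb : 2 ≤ qb) (f : ℕ → K)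
    (h : ∀ α : K, ∑ i ∈ Finset.range e, f i * α ^ qb ^ i = 0) (j : ℕ) (hj : j < e) : f j = 0 := by
  have : (∑ i ∈ Finset.range e, Polynomial.C (f i) * Polynomial.X ^ qb ^ i) = 0 := by
    apply Polynomial.funext
    intro α
    simpa [Polynomial.eval_finsetSum] using h α
  rw [← aux_coeff qb e hqb f j hj, this, Polynomial.coeff_zero]

lemma aux_trace_surj {K : Type} [Field K] [IsAlgClosed K] (qb e : ℕ) (hqb : 2 ≤ qb) (he : 0 < e)
    (d : K) : ∃ α : K, ∑ i ∈ Finset.range e, α ^ qb ^ i = d := by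
  set P : Polynomial K :=
    (∑ i ∈ Finset.range e, Polynomial.C ((fun _ => 1 : ℕ → K) i) * Polynomial.X ^ qb ^ i)
      - Polynomial.C d with hP
  have h1 : P.coeff 1 = 1 := by
    have := aux_coeff qb e hqb (fun _ => (1 : K)) 0 he
    rw [pow_zero] at this
    rw [hP, Polynomial.coeff_sub, this, Polynomial.coeff_C]
    simp
  have hdeg : P.degree ≠ 0 := by
    intro h
    have h2 := Polynomial.eq_C_of_degree_eq_zero h
    rw [h2, Polynomial.coeff_C] at h1
    simp at h1
  obtain ⟨α, hα⟩ := IsAlgClosed.exists_root P hdeg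
  refine ⟨α, ?_⟩
  simp only [hP, Polynomial.IsRoot, Polynomial.eval_sub, Polynomial.eval_finsetSum,
    Polynomial.eval_mul, Polynomial.eval_C, Polynomial.eval_pow, Polynomial.eval_X, one_mul] at hα
  exact sub_eq_zero.1 hα

section
variable (K : Type) [Field K] (c : K) (q qb t e : ℕ)

lemma aux_point (α β γ : K) (h1 : γ ^ t = β ^ q ^ 2 - β)
    (h2 : c * β ^ (q + 1) = ∑ i ∈ Finset.range e, α ^ qb ^ i)
    (P : MvPolynomial (Fin 3) K) (hP : P ∈ XIdeal K c q qb t e) :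
    aeval ![α, β, γ] P = 0 := by
  have : XIdeal K c q qb t e ≤ RingHom.ker (aeval (R := K) ![α, β, γ]) := by
    rw [XIdeal, Ideal.span_le]
    rintro x (rfl | rfl)
    · simp [RingHom.mem_ker, h1]
    · simp [RingHom.mem_ker, h2]
  exact this hP

/-- The canonical map from the polynomial ring to the function field. -/
noncomputable def piMap : MvPolynomial (Fin 3) K →ₐ[K] XField K c q qb t e :=
  (IsScalarTower.toAlgHom K (XRing K c q qb t e) (XField K c q qb t e)).comp
    (Ideal.Quotient.mkₐ K (XIdeal K c q qb t e))

lemma piMap_X0 : piMap K c q qb t e (X 0) = Xx K c q qb t e := rfl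
lemma piMap_X1 : piMap K c q qb t e (X 1) = Xy K c q qb t e := rfl
lemma piMap_X2 : piMap K c q qb t e (X 2) = Xz K c q qb t e := rfl

lemma piMap_of_mem {P : MvPolynomial (Fin 3) K} (h : P ∈ XIdeal K c q qb t e) :
    piMap K c q qb t e P = 0 := by
  have : Ideal.Quotient.mk (XIdeal K c q qb t e) P = 0 := Ideal.Quotient.eq_zero_iff_mem.2 h
  change algebraMap (XRing K c q qb t e) (XField K c q qb t e)
    (Ideal.Quotient.mk (XIdeal K c q qb t e) P) = 0
  rw [this, map_zero]

lemma mem_of_piMap {P : MvPolynomial (Fin 3) K}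
    (h : piMap K c q qb t e P = 0) : P ∈ XIdeal K c q qb t e := by
  change algebraMap (XRing K c q qb t e) (XField K c q qb t e)
    (Ideal.Quotient.mk (XIdeal K c q qb t e) P) = 0 at h
  have h2 := (IsFractionRing.injective (XRing K c q qb t e) (XField K c q qb t e))
    (h.trans (map_zero _).symm)
  exact Ideal.Quotient.eq_zero_iff_mem.1 h2

lemma rel1 : Xz K c q qb t e ^ t = Xy K c q qb t e ^ q ^ 2 - Xy K c q qb t e := by
  have := piMap_of_mem K c q qb t e
    (P := X 2 ^ t - (X 1 ^ (q ^ 2) - X 1)) (Ideal.subset_span (by simp))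
  simp only [map_sub, map_pow, piMap_X1, piMap_X2] at this
  exact sub_eq_zero.1 this

lemma rel2 : algebraMap K (XField K c q qb t e) c * Xy K c q qb t e ^ (q + 1)
    = ∑ i ∈ Finset.range e, Xx K c q qb t e ^ qb ^ i := by
  have := piMap_of_mem K c q qb t e
    (P := C c * X 1 ^ (q + 1) - ∑ i ∈ Finset.range e, X 0 ^ qb ^ i) (Ideal.subset_span (by simp))
  simp only [map_sub, map_pow, map_mul, map_sum, piMap_X1, piMap_X0] at this
  rw [show (piMap K c q qb t e) (C c) = algebraMap K _ c from AlgHom.commutes _ c] at this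
  exact sub_eq_zero.1 this

/-- Scaling endomorphism of the coordinate ring. -/
noncomputable def scaleHom (l u r : K) (hr : r ^ t = u) (hu : u ^ q ^ 2 = u)
    (hlu : l = u ^ (q + 1)) (hl : l ^ qb = l) : XRing K c q qb t e →ₐ[K] XRing K c q qb t e :=
  Ideal.quotientMapₐ (XIdeal K c q qb t e)
    (aeval (R := K) (![C l * X 0, C u * X 1, C r * X 2] : Fin 3 → MvPolynomial (Fin 3) K) :
      MvPolynomial (Fin 3) K →ₐ[K] MvPolynomial (Fin 3) K) (by
    have hl' : ∀ i, l ^ qb ^ i = l := by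
      intro i
      induction i with
      | zero => simp
      | succ i ih => rw [pow_succ, pow_mul, ih, hl]
    rw [XIdeal, Ideal.span_le]
    rintro x (rfl | rfl)
    · have h : aeval (R := K) (![C l * X 0, C u * X 1, C r * X 2] : Fin 3 → MvPolynomial (Fin 3) K)
          (X 2 ^ t - (X 1 ^ (q ^ 2) - X 1) : MvPolynomial (Fin 3) K)
          = C u * (X 2 ^ t - (X 1 ^ (q ^ 2) - X 1)) := by
        simp only [map_sub, map_pow, aeval_X, mul_pow, Matrix.cons_val]
        simp only [← C_pow]
        rw [hr, hu]; ring
      refine Ideal.mem_comap.2 (Set.mem_of_eq_of_mem h ?_)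
      exact Ideal.mul_mem_left _ _ (Ideal.subset_span (by simp))
    · have h : aeval (R := K) (![C l * X 0, C u * X 1, C r * X 2] : Fin 3 → MvPolynomial (Fin 3) K)
          (C c * X 1 ^ (q + 1) - ∑ i ∈ Finset.range e, X 0 ^ qb ^ i : MvPolynomial (Fin 3) K)
          = C l * (C c * X 1 ^ (q + 1) - ∑ i ∈ Finset.range e, X 0 ^ qb ^ i) := by
        simp only [map_sub, map_mul, map_sum, map_pow, aeval_X, Matrix.cons_val, mul_pow]
        simp only [← C_pow, hl', ← Finset.mul_sum, ← hlu, aeval_C, algebraMap_eq]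
        ring
      refine Ideal.mem_comap.2 (Set.mem_of_eq_of_mem h ?_)
      exact Ideal.mul_mem_left _ _ (Ideal.subset_span (by simp)))

lemma scaleHom_mk (l u r : K) (hr : r ^ t = u) (hu : u ^ q ^ 2 = u)
    (hlu : l = u ^ (q + 1)) (hl : l ^ qb = l) (P : MvPolynomial (Fin 3) K) :
    scaleHom K c q qb t e l u r hr hu hlu hl (Ideal.Quotient.mk _ P)
      = Ideal.Quotient.mk _ (aeval (R := K) (![C l * X 0, C u * X 1, C r * X 2] : Fin 3 → MvPolynomial (Fin 3) K) P) := rfl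

/-- The action of the roots of unity. -/
noncomputable def scaleMonoidHom (N : ℕ)
    (hN1 : ∀ r : K, r ^ N = 1 → (r ^ t) ^ q ^ 2 = r ^ t)
    (hN2 : ∀ r : K, r ^ N = 1 → ((r ^ t) ^ (q + 1)) ^ qb = (r ^ t) ^ (q + 1)) :
    rootsOfUnity N K →* (XRing K c q qb t e →ₐ[K] XRing K c q qb t e) where
  toFun r := scaleHom K c q qb t e _ _ ((r : Kˣ) : K) rfl
    (hN1 _ ((mem_rootsOfUnity' _ _).1 r.2)) rfl (hN2 _ ((mem_rootsOfUnity' _ _).1 r.2))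
  map_one' := by
    apply Ideal.Quotient.algHom_ext
    apply MvPolynomial.algHom_ext
    intro i
    have h1 : ∀ r : rootsOfUnity N K, ((r : Kˣ) : K) ^ N = 1 :=
      fun r => (mem_rootsOfUnity' _ _).1 r.2
    refine (scaleHom_mk K c q qb t e _ _ _ rfl (hN1 _ (h1 1)) rfl (hN2 _ (h1 1)) (X i)).trans ?_
    change _ = Ideal.Quotient.mk _ (X i)
    fin_cases i <;> simp
  map_mul' r r' := by
    apply Ideal.Quotient.algHom_ext
    apply MvPolynomial.algHom_ext
    intro i
    have h1 : ∀ r : rootsOfUnity N K, ((r : Kˣ) : K) ^ N = 1 :=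
      fun r => (mem_rootsOfUnity' _ _).1 r.2
    refine (scaleHom_mk K c q qb t e _ _ _ rfl (hN1 _ (h1 (r * r'))) rfl
      (hN2 _ (h1 (r * r'))) (X i)).trans ?_
    symm
    refine (scaleHom_mk K c q qb t e _ _ _ rfl (hN1 _ (h1 r)) rfl (hN2 _ (h1 r))
      (aeval (R := K) (![C ((((r' : Kˣ) : K) ^ t) ^ (q + 1)) * X 0,
        C (((r' : Kˣ) : K) ^ t) * X 1, C ((r' : Kˣ) : K) * X 2] : Fin 3 → MvPolynomial (Fin 3) K) (X i))).trans ?_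
    congr 1
    fin_cases i <;> simp [mul_pow] <;> ring

end

section
variable (K : Type) [Field K] (c : K) (q qb t e : ℕ) [hI : (XIdeal K c q qb t e).IsPrime]

lemma alg_ext (σ τ : XField K c q qb t e ≃ₐ[K] XField K c q qb t e)
    (h0 : σ (Xx K c q qb t e) = τ (Xx K c q qb t e))
    (h1 : σ (Xy K c q qb t e) = τ (Xy K c q qb t e))
    (h2 : σ (Xz K c q qb t e) = τ (Xz K c q qb t e)) : σ = τ := by
  have key : (σ : XField K c q qb t e →ₐ[K] XField K c q qb t e).comp (piMap K c q qb t e)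
      = (τ : XField K c q qb t e →ₐ[K] XField K c q qb t e).comp (piMap K c q qb t e) := by
    apply MvPolynomial.algHom_ext
    intro i
    fin_cases i
    · exact h0
    · exact h1
    · exact h2
  have key2 : ∀ b : XRing K c q qb t e, σ (algebraMap _ (XField K c q qb t e) b)
      = τ (algebraMap _ (XField K c q qb t e) b) := by
    intro b
    obtain ⟨P, rfl⟩ := Ideal.Quotient.mk_surjective b
    exact DFunLike.congr_fun key P
  ext w
  obtain ⟨u, v, -, rfl⟩ := IsFractionRing.div_surjective (A := XRing K c q qb t e) w
  rw [map_div₀, map_div₀, key2, key2]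

/-- The action of the roots of unity on the function field. -/
noncomputable def fieldHom (N : ℕ)
    (hN1 : ∀ r : K, r ^ N = 1 → (r ^ t) ^ q ^ 2 = r ^ t)
    (hN2 : ∀ r : K, r ^ N = 1 → ((r ^ t) ^ (q + 1)) ^ qb = (r ^ t) ^ (q + 1)) :
    rootsOfUnity N K →* (XField K c q qb t e ≃ₐ[K] XField K c q qb t e) :=
  (IsFractionRing.fieldEquivOfAlgEquivHom (A := K) (B := XRing K c q qb t e) K
    (XField K c q qb t e)).comp
    ((AlgEquiv.algHomUnitsEquiv K (XRing K c q qb t e)).toMonoidHom.comp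
      (scaleMonoidHom K c q qb t e N hN1 hN2).toHomUnits)

lemma fieldHom_apply (N : ℕ)
    (hN1 : ∀ r : K, r ^ N = 1 → (r ^ t) ^ q ^ 2 = r ^ t)
    (hN2 : ∀ r : K, r ^ N = 1 → ((r ^ t) ^ (q + 1)) ^ qb = (r ^ t) ^ (q + 1))
    (r : rootsOfUnity N K) (P : MvPolynomial (Fin 3) K) :
    fieldHom K c q qb t e N hN1 hN2 r (piMap K c q qb t e P)
      = piMap K c q qb t e (aeval (R := K) (![C ((((r : Kˣ) : K) ^ t) ^ (q + 1)) * X 0,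
          C (((r : Kˣ) : K) ^ t) * X 1, C ((r : Kˣ) : K) * X 2] : Fin 3 → MvPolynomial (Fin 3) K) P) := by
  change IsFractionRing.fieldEquivOfAlgEquiv (A := K) (B := XRing K c q qb t e)
    (C := XRing K c q qb t e) K
    (XField K c q qb t e) (XField K c q qb t e) _
      (algebraMap (XRing K c q qb t e) _ (Ideal.Quotient.mk _ P)) = _
  rw [IsFractionRing.fieldEquivOfAlgEquiv_algebraMap]
  rfl

end

lemma abstract_final {K F : Type} [Field K] [Field F] [Algebra K F] (x y z : F) (N q qb t : ℕ)
    (hz : z ≠ 0)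
    (hext : ∀ σ τ : F ≃ₐ[K] F, σ x = τ x → σ y = τ y → σ z = τ z → σ = τ)
    (φ : rootsOfUnity N K →* (F ≃ₐ[K] F)) (hN : N = (q + 1) * ((qb - 1) * t))
    (hqb : 1 ≤ qb)
    (hx : ∀ r, φ r x = algebraMap K F ((((r : Kˣ) : K) ^ t) ^ (q + 1)) * x)
    (hy : ∀ r, φ r y = algebraMap K F (((r : Kˣ) : K) ^ t) * y)
    (hzz : ∀ r, φ r z = algebraMap K F ((r : Kˣ) : K) * z)
    (hcard : Nat.card (rootsOfUnity N K) = N) (hcyc : IsCyclic (rootsOfUnity N K))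
    (hnec : ∀ σ : F ≃ₐ[K] F, ∀ l u r : K, l ≠ 0 → u ≠ 0 → r ≠ 0 →
      σ x = algebraMap K F l * x → σ y = algebraMap K F u * y → σ z = algebraMap K F r * z →
      u ^ q ^ 2 = u ∧ l = u ^ (q + 1) ∧ l ^ qb = l ∧ r ^ t = u) :
    ∃ D : Subgroup (F ≃ₐ[K] F), (D : Set (F ≃ₐ[K] F)) =
      {σ | ∃ l u r : K, l ≠ 0 ∧ u ≠ 0 ∧ r ≠ 0 ∧ σ x = algebraMap K F l * x ∧
        σ y = algebraMap K F u * y ∧ σ z = algebraMap K F r * z} ∧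
      IsCyclic D ∧ Nat.card D = (q + 1) * ((qb - 1) * t) := by
  have hinj : Function.Injective φ := by
    intro r r' h
    have h1 := hzz r
    rw [h, hzz r'] at h1
    have h2 := (algebraMap K F).injective (mul_right_cancel₀ hz h1)
    exact Subtype.ext (Units.ext h2.symm)
  refine ⟨φ.range, ?_, ?_, ?_⟩
  · ext σ
    constructor
    · rintro ⟨r, rfl⟩
      have hr : ((r : Kˣ) : K) ≠ 0 := Units.ne_zero _
      exact ⟨_, _, _, pow_ne_zero _ (pow_ne_zero _ hr), pow_ne_zero _ hr, hr, hx r, hy r, hzz r⟩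
    · rintro ⟨l, u, r, hl, hu, hr, h1, h2, h3⟩
      obtain ⟨g1, g2, g3, g4⟩ := hnec σ l u r hl hu hr h1 h2 h3
      have hl1 : l ^ (qb - 1) = 1 := by
        apply mul_right_cancel₀ hl
        rw [← pow_succ, Nat.sub_add_cancel hqb, g3, one_mul]
      have hrN : r ^ N = 1 := by
        rw [hN, show (q + 1) * ((qb - 1) * t) = t * (q + 1) * (qb - 1) by ring, pow_mul, pow_mul,
          g4, ← g2, hl1]
      let r' : rootsOfUnity N K := ⟨Units.mk0 r hr, (mem_rootsOfUnity' _ _).2 hrN⟩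
      refine ⟨r', hext _ _ ?_ ?_ ?_⟩
      · rw [hx, h1, g2, ← g4]; rfl
      · rw [hy, h2, ← g4]; rfl
      · rw [hzz, h3]; rfl
  · exact (MonoidHom.ofInjective hinj).isCyclic.1 hcyc
  · rw [← Nat.card_congr (MonoidHom.ofInjective hinj).toEquiv, hcard, hN]

section
variable (K : Type) [Field K] [IsAlgClosed K] (c : K) (q qb t e : ℕ)

lemma vanish_y (hc : c ≠ 0) (hqb : 2 ≤ qb) (he : 0 < e) (ht : 0 < t)
    (P : Polynomial K) (h : Polynomial.aeval (Xy K c q qb t e) P = 0) : P = 0 := by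
  have : Infinite K := IsAlgClosed.instInfinite
  apply Polynomial.funext
  intro β
  obtain ⟨α, hα⟩ := aux_trace_surj qb e hqb he (c * β ^ (q + 1))
  obtain ⟨γ, hγ⟩ := IsAlgClosed.exists_pow_nat_eq (β ^ q ^ 2 - β) ht
  have h1 : piMap K c q qb t e (Polynomial.aeval (X 1) P) = 0 := by
    rw [← Polynomial.aeval_algHom_apply, piMap_X1, h]
  have h2 := aux_point K c q qb t e α β γ hγ hα.symm _ (mem_of_piMap K c q qb t e h1)
  rw [← Polynomial.aeval_algHom_apply] at h2
  simpa [Polynomial.aeval_def] using h2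

lemma vanish_x (hc : c ≠ 0) (ht : 0 < t)
    (P : Polynomial K) (h : Polynomial.aeval (Xx K c q qb t e) P = 0) : P = 0 := by
  have : Infinite K := IsAlgClosed.instInfinite
  apply Polynomial.funext
  intro α
  obtain ⟨β, hβ⟩ := IsAlgClosed.exists_pow_nat_eq
    (c⁻¹ * ∑ i ∈ Finset.range e, α ^ qb ^ i) (Nat.succ_pos q)
  obtain ⟨γ, hγ⟩ := IsAlgClosed.exists_pow_nat_eq (β ^ q ^ 2 - β) ht
  have h1 : piMap K c q qb t e (Polynomial.aeval (X 0) P) = 0 := by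
    rw [← Polynomial.aeval_algHom_apply, piMap_X0, h]
  have h2 := aux_point K c q qb t e α β γ hγ (by
    rw [← Nat.succ_eq_add_one, hβ, mul_inv_cancel_left₀ hc]) _ (mem_of_piMap K c q qb t e h1)
  rw [← Polynomial.aeval_algHom_apply] at h2
  simpa [Polynomial.aeval_def] using h2

lemma z_ne_zero [hI : (XIdeal K c q qb t e).IsPrime] (hc : c ≠ 0) (hq : 2 ≤ q) (hqb : 2 ≤ qb)
    (he : 0 < e) (ht : 0 < t) : Xz K c q qb t e ≠ 0 := by
  intro h
  have h1 := rel1 K c q qb t e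
  rw [h, zero_pow ht.ne'] at h1
  have h2 := vanish_y K c q qb t e hc hqb he ht (Polynomial.X ^ q ^ 2 - Polynomial.X)
    (by simp only [map_sub, map_pow, Polynomial.aeval_X]; exact h1.symm)
  have h3 := congrArg (fun P => Polynomial.coeff P 1) h2
  have : 1 ≠ q ^ 2 := by nlinarith
  simp [Polynomial.coeff_X_pow, this] at h3

lemma necessary [hI : (XIdeal K c q qb t e).IsPrime] (hc : c ≠ 0) (hq : 2 ≤ q) (hqb : 2 ≤ qb)
    (he : 0 < e) (ht : 0 < t) (heq : e = 1 → qb = q)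
    (σ : XField K c q qb t e ≃ₐ[K] XField K c q qb t e) (l u r : K)
    (h0 : σ (Xx K c q qb t e) = algebraMap K (XField K c q qb t e) l * Xx K c q qb t e)
    (h1 : σ (Xy K c q qb t e) = algebraMap K (XField K c q qb t e) u * Xy K c q qb t e)
    (h2 : σ (Xz K c q qb t e) = algebraMap K (XField K c q qb t e) r * Xz K c q qb t e) :
    u ^ q ^ 2 = u ∧ l = u ^ (q + 1) ∧ l ^ qb = l ∧ r ^ t = u := by
  have : Infinite K := IsAlgClosed.instInfinite
  have e1 := congrArg σ (rel1 K c q qb t e)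
  have e2 := congrArg σ (rel2 K c q qb t e)
  simp only [map_sub, map_pow, map_mul, map_sum, h0, h1, h2, AlgEquiv.commutes, mul_pow] at e1 e2
  rw [rel1 K c q qb t e] at e1
  rw [mul_left_comm, rel2 K c q qb t e] at e2
  have v1 := vanish_y K c q qb t e hc hqb he ht
    (Polynomial.C (r ^ t - u ^ q ^ 2) * Polynomial.X ^ q ^ 2
      + Polynomial.C (u - r ^ t) * Polynomial.X) (by
    simp only [map_sub, map_add, map_mul, map_pow, Polynomial.aeval_X, Polynomial.aeval_C]
    linear_combination e1)
  have hne : q ^ 2 ≠ 1 := by nlinarith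
  have k1 := congrArg (fun P => Polynomial.coeff P 1) v1
  have k2 := congrArg (fun P => Polynomial.coeff P (q ^ 2)) v1
  simp only [Polynomial.coeff_add, Polynomial.coeff_C_mul, Polynomial.coeff_X_pow,
    Polynomial.coeff_X, hne, hne.symm, if_true, if_false, Polynomial.coeff_zero] at k1 k2
  have hru : r ^ t = u := by linear_combination -k1
  have huu : u ^ q ^ 2 = u := by linear_combination -k2 - k1
  have v2 := vanish_x K c q qb t e hc ht
    (∑ i ∈ Finset.range e, Polynomial.C ((fun i => u ^ (q + 1) - l ^ qb ^ i : ℕ → K) i)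
      * Polynomial.X ^ qb ^ i) (by
    simp only [map_sub, map_sum, map_mul, map_pow, Polynomial.aeval_X, Polynomial.aeval_C, sub_mul,
      Finset.sum_sub_distrib, ← Finset.mul_sum]
    exact sub_eq_zero.2 e2)
  have hco : ∀ j < e, u ^ (q + 1) = l ^ qb ^ j := by
    intro j hj
    have := aux_coeff qb e hqb (fun i => u ^ (q + 1) - l ^ qb ^ i : ℕ → K) j hj
    rw [v2, Polynomial.coeff_zero] at this
    exact sub_eq_zero.1 this.symm
  have hl : l = u ^ (q + 1) := by rw [hco 0 he]; simp
  refine ⟨huu, hl, ?_, hru⟩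
  by_cases h : e = 1
  · rw [heq h, hl, ← pow_mul, show (q + 1) * q = q ^ 2 + q by ring, pow_add, huu]; ring
  · have := hco 1 (by omega)
    rw [← hl, pow_one] at this
    exact this.symm

end

set_option synthInstance.maxHeartbeats 1000000 in
set_option maxHeartbeats 2000000 in
/-- Theorem: the set `D' = {σ ∈ Aut(F'/K) : σ x = λx, σ y = μy, σ z = ρz for some
nonzero λ, μ, ρ ∈ K}` is a cyclic subgroup of `Aut(F'/K)` of order `(q+1)(q̄-1)(m/s)`;
moreover for such a `σ` one necessarily has `μ^{q^2} = μ`, `λ = μ^{q+1}`, `λ^q̄ = λ`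
and `ρ^{m/s} = μ`. -/
theorem stmt10 (p a b q qb n m s : ℕ) (hp : p.Prime) (ha : 0 < a) (hq : q = p ^ a)
    (hb : 0 < b) (hba : b ∣ a) (hqb : qb = p ^ b)
    (hn : 3 ≤ n) (hodd : Odd n) (hm : m * (q + 1) = q ^ n + 1)
    (hs : s ∣ m) (hs0 : 0 < s)
    (K : Type) [Field K] [IsAlgClosed K] [CharP K p]
    (c : K) (hc2 : c ^ q ^ 2 = c) (hc : c ^ (q - 1) = -1)
    [hI : (XIdeal K c q qb (m / s) (a / b)).IsPrime] :
    (∃ D : Subgroup (XField K c q qb (m / s) (a / b) ≃ₐ[K] XField K c q qb (m / s) (a / b)),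
      (D : Set (XField K c q qb (m / s) (a / b) ≃ₐ[K] XField K c q qb (m / s) (a / b)))
          = {σ | ∃ l u r : K, l ≠ 0 ∧ u ≠ 0 ∧ r ≠ 0 ∧
              σ (Xx K c q qb (m / s) (a / b))
                = algebraMap K (XField K c q qb (m / s) (a / b)) l * Xx K c q qb (m / s) (a / b) ∧
              σ (Xy K c q qb (m / s) (a / b))
                = algebraMap K (XField K c q qb (m / s) (a / b)) u * Xy K c q qb (m / s) (a / b) ∧
              σ (Xz K c q qb (m / s) (a / b))
                = algebraMap K (XField K c q qb (m / s) (a / b)) r * Xz K c q qb (m / s) (a / b)} ∧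
      IsCyclic D ∧ Nat.card D = (q + 1) * ((qb - 1) * (m / s))) ∧
    ∀ σ : XField K c q qb (m / s) (a / b) ≃ₐ[K] XField K c q qb (m / s) (a / b), ∀ l u r : K,
      l ≠ 0 → u ≠ 0 → r ≠ 0 →
      σ (Xx K c q qb (m / s) (a / b))
        = algebraMap K (XField K c q qb (m / s) (a / b)) l * Xx K c q qb (m / s) (a / b) →
      σ (Xy K c q qb (m / s) (a / b))
        = algebraMap K (XField K c q qb (m / s) (a / b)) u * Xy K c q qb (m / s) (a / b) →
      σ (Xz K c q qb (m / s) (a / b))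
        = algebraMap K (XField K c q qb (m / s) (a / b)) r * Xz K c q qb (m / s) (a / b) →
      u ^ q ^ 2 = u ∧ l = u ^ (q + 1) ∧ l ^ qb = l ∧ r ^ (m / s) = u := by
  subst hq hqb
  have hm0 : 0 < m := by
    rcases Nat.eq_zero_or_pos m with h | h
    · rw [h] at hm; omega
    · exact h
  have ht : 0 < m / s := Nat.div_pos (Nat.le_of_dvd hm0 hs) hs0
  have he : 0 < a / b := Nat.div_pos (Nat.le_of_dvd ha hba) hb
  have hq2 : 2 ≤ p ^ a := hp.two_le.trans (Nat.le_self_pow ha.ne' p)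
  have hqb2 : 2 ≤ p ^ b := hp.two_le.trans (Nat.le_self_pow hb.ne' p)
  have hc0 : c ≠ 0 := by
    rintro rfl
    rw [zero_pow (by omega)] at hc
    exact (neg_ne_zero.2 one_ne_zero) hc.symm
  have heq : a / b = 1 → p ^ b = p ^ a := by
    intro h
    rw [← Nat.div_mul_cancel hba, h, one_mul]
  have hnec := necessary K c (p ^ a) (p ^ b) (m / s) (a / b) hc0 hq2 hqb2 he ht heq
  refine ⟨?_, fun σ l u r _ _ _ h0 h1 h2 => hnec σ l u r h0 h1 h2⟩
  set N := (p ^ a + 1) * ((p ^ b - 1) * (m / s)) with hN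
  have hdvd : (p ^ b - 1) ∣ (p ^ a - 1) := Nat.pow_sub_one_dvd_pow_sub_one p hba
  have hN1 : ∀ r : K, r ^ N = 1 → (r ^ (m / s)) ^ (p ^ a) ^ 2 = r ^ (m / s) := by
    intro r hr
    obtain ⟨k, hk⟩ := hdvd
    have hsq : (p ^ a) ^ 2 = (p ^ a + 1) * ((p ^ b - 1) * k) + 1 := by
      rw [← hk]
      obtain ⟨j, hj⟩ : ∃ j, p ^ a = j + 1 := ⟨p ^ a - 1, by omega⟩
      rw [hj, Nat.add_sub_cancel]; ring
    rw [hsq, pow_succ, ← pow_mul,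
      show m / s * ((p ^ a + 1) * ((p ^ b - 1) * k)) = N * k by rw [hN]; ring, pow_mul, hr,
      one_pow, one_mul]
  have hN2 : ∀ r : K, r ^ N = 1 → ((r ^ (m / s)) ^ (p ^ a + 1)) ^ p ^ b
      = (r ^ (m / s)) ^ (p ^ a + 1) := by
    intro r hr
    have h1 : ((r ^ (m / s)) ^ (p ^ a + 1)) ^ (p ^ b - 1) = 1 := by
      rw [← pow_mul, ← pow_mul, ← hr, hN]; congr 1; ring
    conv_lhs => rw [← Nat.sub_add_cancel (show 1 ≤ p ^ b by omega), pow_succ, h1, one_mul]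
  have hpN : ¬ p ∣ N := by
    rw [hN, hp.dvd_mul, hp.dvd_mul]
    have hone : ¬ p ∣ 1 := fun h => hp.one_lt.ne' (Nat.dvd_one.1 h)
    have hpa : p ∣ p ^ a := dvd_pow_self p ha.ne'
    have hpb : p ∣ p ^ b := dvd_pow_self p hb.ne'
    rintro (h | h | h)
    · exact hone ((Nat.dvd_add_right hpa).1 h)
    · apply hone
      have := (Nat.dvd_sub hpb h)
      rwa [show p ^ b - (p ^ b - 1) = 1 by omega] at this
    · have h1 : p ∣ (p ^ a) ^ n + 1 := by
        rw [← hm]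
        exact ((h.trans (Nat.div_dvd_of_dvd hs)).mul_right _)
      exact hone ((Nat.dvd_add_right (dvd_pow hpa (by omega))).1 h1)
  haveI : NeZero (N : K) := ⟨fun h => hpN ((CharP.cast_eq_zero_iff K p N).1 h)⟩
  haveI : NeZero N := .of_neZero_natCast K
  have happ := fieldHom_apply K c (p ^ a) (p ^ b) (m / s) (a / b) N hN1 hN2
  refine abstract_final _ _ _ N (p ^ a) (p ^ b) (m / s)
    (z_ne_zero K c (p ^ a) (p ^ b) (m / s) (a / b) hc0 hq2 hqb2 he ht)
    (alg_ext K c (p ^ a) (p ^ b) (m / s) (a / b))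
    (fieldHom K c (p ^ a) (p ^ b) (m / s) (a / b) N hN1 hN2) hN (by omega) ?_ ?_ ?_
    (HasEnoughRootsOfUnity.natCard_rootsOfUnity K N) inferInstance
    (fun σ l u r _ _ _ h0 h1 h2 => hnec σ l u r h0 h1 h2)
  · intro r
    have := happ r (X 0)
    rw [aeval_X] at this
    refine this.trans ?_
    exact (map_mul _ _ _).trans (congrArg₂ _ (AlgHom.commutes _ _) rfl)
  · intro r
    have := happ r (X 1)
    rw [aeval_X] at this
    refine this.trans ?_
    exact (map_mul _ _ _).trans (congrArg₂ _ (AlgHom.commutes _ _) rfl)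
  · intro r
    have := happ r (X 2)
    rw [aeval_X] at this
    refine this.trans ?_
    exact (map_mul _ _ _).trans (congrArg₂ _ (AlgHom.commutes _ _) rfl)
end

section
/- The field extension F'/K(z) is Galois of degree q^3/q̄, where K(z) is the subfield of F' generated over K by z. -/
open MvPolynomial

lemma aux_addpow {R : Type*} [CommRing R] (p N : ℕ) [Fact p.Prime] [CharP R p] (hN : ∃ k, N = p ^ k)
    (u v : R) : (u + v) ^ N = u ^ N + v ^ N := by
  obtain ⟨k, rfl⟩ := hN
  rw [add_pow_char_pow]

lemma aux_subpow {R : Type*} [CommRing R] (p k : ℕ) [Fact p.Prime] [CharP R p]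
    (u v : R) : (u - v) ^ p ^ k = u ^ p ^ k - v ^ p ^ k := by
  rw [sub_pow_char_pow]

lemma aux_negpow {R : Type*} [CommRing R] (p k : ℕ) [Fact p.Prime] [CharP R p]
    (u : R) : (-u) ^ p ^ k = - u ^ p ^ k := by
  have := aux_subpow p k 0 u
  have hp := (Fact.out : p.Prime)
  rwa [zero_sub, zero_pow (pow_ne_zero _ hp.ne_zero), zero_sub] at this

lemma aux_tr_add {R : Type*} [CommRing R] (p b e : ℕ) [Fact p.Prime] [CharP R p] (u v : R) :
    ∑ i ∈ Finset.range e, (u + v) ^ (p ^ b) ^ i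
      = ∑ i ∈ Finset.range e, u ^ (p ^ b) ^ i + ∑ i ∈ Finset.range e, v ^ (p ^ b) ^ i := by
  rw [← Finset.sum_add_distrib]
  refine Finset.sum_congr rfl fun i _ => ?_
  rw [← pow_mul, add_pow_char_pow]

lemma aux_tr_sub {R : Type*} [CommRing R] (p b e : ℕ) [Fact p.Prime] [CharP R p] (u : R) :
    ∑ i ∈ Finset.range e, (u - u ^ (p ^ b)) ^ (p ^ b) ^ i = u - u ^ (p ^ b) ^ e := by
  have : ∀ i, (u - u ^ (p ^ b)) ^ (p ^ b) ^ i = u ^ (p ^ b) ^ i - u ^ (p ^ b) ^ (i + 1) := by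
    intro i
    rw [← pow_mul p b i, sub_pow_char_pow, ← pow_mul u, pow_succ' (p ^ b) i, pow_mul p b i]
  simp only [this]
  rw [Finset.sum_range_sub']
  simp

lemma aux_key {R : Type*} [CommRing R] (p b e q : ℕ) [Fact p.Prime] [CharP R p]
    (hq : q = (p ^ b) ^ e) (x y c α β : R) (hc : c ^ q = -c) (hα : α ^ q ^ 2 = α)
    (hx : c * y ^ (q + 1) = ∑ i ∈ Finset.range e, x ^ (p ^ b) ^ i)
    (hβ : ∑ i ∈ Finset.range e, β ^ (p ^ b) ^ i = c * α ^ (q + 1)) :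
    c * (y + α) ^ (q + 1)
      = ∑ i ∈ Finset.range e, (x + (c * α ^ q * y - (c * α ^ q * y) ^ (p ^ b)) + β) ^ (p ^ b) ^ i := by
  rw [aux_tr_add, aux_tr_add, aux_tr_sub, hβ, ← hx, ← hq]
  have h1 : (y + α) ^ q = y ^ q + α ^ q := by
    rw [hq, ← pow_mul, add_pow_char_pow]
  have h2 : (α ^ q) ^ q = α := by rw [← pow_mul, ← sq, hα]
  rw [mul_pow, mul_pow, h2, hc, pow_succ (y + α), h1]
  ring

lemma aux_upper {K F : Type*} [Field K] [Field F] [Algebra K F] (x y z : F)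
    (hgen : IntermediateField.adjoin K {x, y, z} = ⊤) (c : K) (N q t e qb : ℕ) (hN : 1 < N)
    (hqb : 1 < qb) (hy : z ^ t = y ^ N - y)
    (hx : algebraMap K F c * y ^ (q + 1) = ∑ i ∈ Finset.range (e + 1), x ^ qb ^ i) :
    FiniteDimensional (IntermediateField.adjoin K {z}) F ∧
    Module.finrank (IntermediateField.adjoin K {z}) F ≤ N * qb ^ e := by
  set L0 := IntermediateField.adjoin K {z} with hL0
  let zz : L0 := ⟨z, IntermediateField.mem_adjoin_simple_self K z⟩
  set P : Polynomial L0 := Polynomial.X ^ N - (Polynomial.X + Polynomial.C (zz ^ t)) with hP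
  have hdeg : (Polynomial.X + Polynomial.C (zz ^ t) : Polynomial L0).degree < N := by
    rw [Polynomial.degree_X_add_C]; exact_mod_cast hN
  have hPm : P.Monic := Polynomial.monic_X_pow_sub (by rw [Polynomial.degree_X_add_C]; exact_mod_cast hN)
  have hPd : P.natDegree = N := by
    apply Polynomial.natDegree_eq_of_degree_eq_some
    rw [hP, Polynomial.degree_sub_eq_left_of_degree_lt, Polynomial.degree_X_pow]
    rwa [Polynomial.degree_X_pow]
  have hPy : Polynomial.aeval y P = 0 := by
    have : algebraMap L0 F zz = z := rfl
    simp [hP, this, hy]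
  have hyint : IsIntegral L0 y := ⟨P, hPm, hPy⟩
  set L1 := IntermediateField.adjoin L0 {y} with hL1
  have f1 : FiniteDimensional L0 L1 := IntermediateField.adjoin.finiteDimensional hyint
  have r1 : Module.finrank L0 L1 ≤ N := by
    rw [hL1, IntermediateField.adjoin.finrank hyint, ← hPd]
    exact Polynomial.natDegree_le_of_dvd (minpoly.dvd _ _ hPy) hPm.ne_zero
  let yy : L1 := ⟨y, IntermediateField.mem_adjoin_simple_self L0 y⟩
  set Q : Polynomial L1 := (∑ i ∈ Finset.range (e + 1), Polynomial.X ^ qb ^ i)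
    - Polynomial.C (algebraMap K L1 c * yy ^ (q + 1)) with hQ
  have hQlow : ((∑ i ∈ Finset.range e, Polynomial.X ^ qb ^ i)
    - Polynomial.C (algebraMap K L1 c * yy ^ (q + 1)) : Polynomial L1).degree < (qb ^ e : ℕ) := by
    refine lt_of_le_of_lt (Polynomial.degree_sub_le _ _) (max_lt ?_ ?_)
    · refine lt_of_le_of_lt (Polynomial.degree_sum_le _ _) ?_
      rw [Finset.sup_lt_iff (WithBot.bot_lt_coe _)]
      intro i hi
      rw [Polynomial.degree_X_pow]
      exact_mod_cast Nat.pow_lt_pow_right hqb (Finset.mem_range.1 hi)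
    · refine lt_of_le_of_lt Polynomial.degree_C_le ?_
      exact_mod_cast pow_pos (by omega : 0 < qb) e
  have hQe : Q = Polynomial.X ^ qb ^ e + ((∑ i ∈ Finset.range e, Polynomial.X ^ qb ^ i)
    - Polynomial.C (algebraMap K L1 c * yy ^ (q + 1))) := by
    rw [hQ, Finset.sum_range_succ]; ring
  have hQm : Q.Monic := by rw [hQe]; exact Polynomial.monic_X_pow_add hQlow
  have hQd : Q.natDegree = qb ^ e := by
    apply Polynomial.natDegree_eq_of_degree_eq_some
    rw [hQe, Polynomial.degree_add_eq_left_of_degree_lt, Polynomial.degree_X_pow]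
    rwa [Polynomial.degree_X_pow]
  have hQx : Polynomial.aeval x Q = 0 := by
    have h1 : algebraMap L1 F yy = y := rfl
    have h2 : algebraMap L1 F (algebraMap K L1 c) = algebraMap K F c := rfl
    simp only [hQ, map_sub, map_sum, map_pow, Polynomial.aeval_X, Polynomial.aeval_C, map_mul, h1, h2, hx,
      sub_self]
  have hxint : IsIntegral L1 x := ⟨Q, hQm, hQx⟩
  have htop : IntermediateField.adjoin L1 {x} = ⊤ := by
    rw [eq_top_iff]
    intro w _
    have hw : w ∈ IntermediateField.adjoin K {x, y, z} := by rw [hgen]; trivial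
    have hle : IntermediateField.adjoin K {x, y, z} ≤
        (((IntermediateField.adjoin L1 {x}).restrictScalars L0).restrictScalars K) := by
      rw [IntermediateField.adjoin_le_iff]
      rintro v (rfl | rfl | rfl)
      · exact IntermediateField.mem_adjoin_simple_self L1 v
      · exact (IntermediateField.adjoin L1 {x}).algebraMap_mem yy
      · exact (IntermediateField.adjoin L1 {x}).algebraMap_mem (algebraMap L0 L1 zz)
    exact hle hw
  have f2' : FiniteDimensional L1 (IntermediateField.adjoin L1 {x}) :=
    IntermediateField.adjoin.finiteDimensional hxint
  have r2' : Module.finrank L1 (IntermediateField.adjoin L1 {x}) ≤ qb ^ e := by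
    rw [IntermediateField.adjoin.finrank hxint, ← hQd]
    exact Polynomial.natDegree_le_of_dvd (minpoly.dvd _ _ hQx) hQm.ne_zero
  rw [htop] at f2' r2'
  have f2 : FiniteDimensional L1 F :=
    LinearEquiv.finiteDimensional (IntermediateField.topEquiv (F := L1) (E := F)).toLinearEquiv
  have r2 : Module.finrank L1 F ≤ qb ^ e := by
    rwa [IntermediateField.finrank_top'] at r2'
  refine ⟨FiniteDimensional.trans L0 L1 F, ?_⟩
  have g1 : Module.Free L0 L1 := Module.Free.of_divisionRing L0 L1
  have g2 : Module.Free L1 F := Module.Free.of_divisionRing L1 F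
  rw [← Module.finrank_mul_finrank L0 L1 F]
  exact Nat.mul_le_mul r1 r2

lemma aux_card {K : Type*} [Field K] [IsAlgClosed K] (f : Polynomial K) (hf : f.Separable) :
    Nat.card {β : K // f.eval β = 0} = f.natDegree := by
  classical
  have h := Polynomial.card_rootSet_eq_natDegree (F := K) (K := K) hf (IsAlgClosed.splits _)
  rw [← h, ← Nat.card_eq_fintype_card]
  refine Nat.card_congr (Equiv.subtypeEquivRight fun β => ?_)
  rw [Polynomial.mem_rootSet]
  simp [hf.ne_zero]

lemma aux_count {K : Type*} [Field K] [IsAlgClosed K] (p b e q : ℕ) [Fact p.Prime] [CharP K p]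
    (hb : 0 < b) (hq : q = (p ^ b) ^ (e + 1)) (c : K) :
    Nat.card (Σ α : {α : K // α ^ q ^ 2 = α},
      {β : K // ∑ i ∈ Finset.range (e + 1), β ^ (p ^ b) ^ i = c * α.1 ^ (q + 1)})
      = q ^ 2 * (p ^ b) ^ e := by
  have hp := (Fact.out : p.Prime)
  have hqb : 1 < p ^ b := Nat.one_lt_pow hb.ne' hp.one_lt
  have hq1 : 1 < q ^ 2 := by
    rw [hq, ← pow_mul]; exact Nat.one_lt_pow (by positivity) hqb
  have hpq : ((q : ℕ) : K) = 0 := by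
    rw [hq]; simp [hb.ne']
  have hpb : ((p : K)) ^ b = 0 := by simp [hb.ne']
  have c1 : Nat.card {α : K // α ^ q ^ 2 = α} = q ^ 2 := by
    set P : Polynomial K := Polynomial.X ^ q ^ 2 - Polynomial.X with hP
    have hs : P.Separable := by
      rw [Polynomial.separable_def]
      have : Polynomial.derivative P = -1 := by
        simp [hP, Polynomial.derivative_X_pow, hpq]
      rw [this]
      exact isCoprime_one_right.neg_right
    have hd : P.natDegree = q ^ 2 := by
      apply Polynomial.natDegree_eq_of_degree_eq_some
      rw [hP, Polynomial.degree_sub_eq_left_of_degree_lt, Polynomial.degree_X_pow]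
      rw [Polynomial.degree_X_pow, Polynomial.degree_X]; exact_mod_cast hq1
    refine Eq.trans ?_ ((aux_card P hs).trans hd)
    refine Nat.card_congr (Equiv.subtypeEquivRight fun β => ?_)
    simp [hP, sub_eq_zero]
  have c2 : ∀ v : K, Nat.card {β : K // ∑ i ∈ Finset.range (e + 1), β ^ (p ^ b) ^ i = v}
      = (p ^ b) ^ e := by
    intro v
    set P : Polynomial K := (∑ i ∈ Finset.range (e + 1), Polynomial.X ^ (p ^ b) ^ i)
      - Polynomial.C v with hP
    have hs : P.Separable := by
      rw [Polynomial.separable_def]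
      have : Polynomial.derivative P = 1 := by
        simp [hP, Polynomial.derivative_X_pow, Finset.sum_range_succ', hb.ne']
      rw [this]
      exact isCoprime_one_right
    have hQlow : ((∑ i ∈ Finset.range e, Polynomial.X ^ (p ^ b) ^ i)
      - Polynomial.C v : Polynomial K).degree < ((p ^ b) ^ e : ℕ) := by
      refine lt_of_le_of_lt (Polynomial.degree_sub_le _ _) (max_lt ?_ ?_)
      · refine lt_of_le_of_lt (Polynomial.degree_sum_le _ _) ?_
        rw [Finset.sup_lt_iff (WithBot.bot_lt_coe _)]
        intro i hi
        rw [Polynomial.degree_X_pow]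
        exact_mod_cast Nat.pow_lt_pow_right hqb (Finset.mem_range.1 hi)
      · refine lt_of_le_of_lt Polynomial.degree_C_le ?_
        exact_mod_cast pow_pos (by omega : 0 < p ^ b) e
    have hQe : P = Polynomial.X ^ (p ^ b) ^ e + ((∑ i ∈ Finset.range e, Polynomial.X ^ (p ^ b) ^ i)
      - Polynomial.C v) := by
      rw [hP, Finset.sum_range_succ]; ring
    have hd : P.natDegree = (p ^ b) ^ e := by
      apply Polynomial.natDegree_eq_of_degree_eq_some
      rw [hQe, Polynomial.degree_add_eq_left_of_degree_lt, Polynomial.degree_X_pow]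
      rwa [Polynomial.degree_X_pow]
    refine Eq.trans ?_ ((aux_card P hs).trans hd)
    refine Nat.card_congr (Equiv.subtypeEquivRight fun β => ?_)
    simp [hP, sub_eq_zero, Polynomial.eval_finsetSum]
  have fin1 : Finite {α : K // α ^ q ^ 2 = α} := Nat.finite_of_card_ne_zero (by rw [c1]; omega)
  have fin2 : ∀ v : K, Finite {β : K // ∑ i ∈ Finset.range (e + 1), β ^ (p ^ b) ^ i = v} :=
    fun v => Nat.finite_of_card_ne_zero (by rw [c2]; positivity)
  have := Fintype.ofFinite {α : K // α ^ q ^ 2 = α}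
  rw [Nat.card_sigma]
  simp only [c2]
  rw [Finset.sum_const, Finset.card_univ, ← Nat.card_eq_fintype_card, c1, smul_eq_mul]

/-- Abstract Galois criterion: finrank bounded by `d` and a family of `d` distinct endomorphisms. -/
lemma aux_galois {L F ι : Type*} [Field L] [Field F] [Algebra L F] [FiniteDimensional L F] (d : ℕ)
    (hle : Module.finrank L F ≤ d) (hι : Nat.card ι = d) (φ : ι → (F →ₐ[L] F))
    (hφ : Function.Injective φ) : IsGalois L F ∧ Module.finrank L F = d := by
  have h1 : Nat.card ι ≤ Nat.card (F ≃ₐ[L] F) := by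
    rw [Nat.card_congr (algEquivEquivAlgHom L F).toEquiv]
    exact Nat.card_le_card_of_injective φ hφ
  have h2 : Nat.card (F ≃ₐ[L] F) ≤ Module.finrank L F := by
    rw [Nat.card_eq_fintype_card]
    exact AlgEquiv.card_le
  have h3 : Nat.card (F ≃ₐ[L] F) = Module.finrank L F := by omega
  exact ⟨IsGalois.of_card_aut_eq_finrank _ _ h3, by omega⟩

lemma aux_rel1 (K : Type) [Field K] (c : K) (q qb t e : ℕ) :
    (Ideal.Quotient.mk (XIdeal K c q qb t e) (X 2)) ^ t =
      (Ideal.Quotient.mk (XIdeal K c q qb t e) (X 1)) ^ q ^ 2 -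
      (Ideal.Quotient.mk (XIdeal K c q qb t e) (X 1)) := by
  rw [← map_pow, ← map_pow, ← map_sub, Ideal.Quotient.eq]
  exact Ideal.subset_span (by simp)

lemma aux_rel2 (K : Type) [Field K] (c : K) (q qb t e : ℕ) :
    algebraMap K (XRing K c q qb t e) c *
      (Ideal.Quotient.mk (XIdeal K c q qb t e) (X 1)) ^ (q + 1) =
      ∑ i ∈ Finset.range e, (Ideal.Quotient.mk (XIdeal K c q qb t e) (X 0)) ^ qb ^ i := by
  have h : algebraMap K (XRing K c q qb t e) c = Ideal.Quotient.mk (XIdeal K c q qb t e) (C c) := rfl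
  rw [h]
  simp only [← map_pow]
  rw [← map_mul, ← map_sum, Ideal.Quotient.eq]
  exact Ideal.subset_span (by simp)

/-- Homomorphisms out of the coordinate ring. -/
lemma aux_lift (K : Type) [Field K] (c : K) (q qb t e : ℕ) (A : Type) [CommRing A] [Algebra K A]
    (x y z : A) (h1 : z ^ t = y ^ q ^ 2 - y)
    (h2 : algebraMap K A c * y ^ (q + 1) = ∑ i ∈ Finset.range e, x ^ qb ^ i) :
    ∃ φ : XRing K c q qb t e →ₐ[K] A,
      φ (Ideal.Quotient.mk _ (X 0)) = x ∧ φ (Ideal.Quotient.mk _ (X 1)) = y ∧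
      φ (Ideal.Quotient.mk _ (X 2)) = z := by
  have hker : ∀ f ∈ XIdeal K c q qb t e, (aeval ![x, y, z] : MvPolynomial (Fin 3) K →ₐ[K] A) f = 0 := by
    intro f hf
    have : XIdeal K c q qb t e ≤
        RingHom.ker (aeval ![x, y, z] : MvPolynomial (Fin 3) K →ₐ[K] A) := by
      rw [XIdeal, Ideal.span_le]
      rintro g (rfl | rfl)
      · simp [RingHom.mem_ker, h1]
      · simp [RingHom.mem_ker, h2]
    exact this hf
  refine ⟨Ideal.Quotient.liftₐ _ (aeval ![x, y, z]) hker, ?_, ?_, ?_⟩ <;>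
    exact (Ideal.Quotient.lift_mk _ _ _).trans (by simp)

lemma aux_ext (K : Type) [Field K] (c : K) (q qb t e : ℕ) (A : Type) [CommRing A] [Algebra K A]
    (φ ψ : XRing K c q qb t e →ₐ[K] A)
    (h0 : φ (Ideal.Quotient.mk _ (X 0)) = ψ (Ideal.Quotient.mk _ (X 0)))
    (h1 : φ (Ideal.Quotient.mk _ (X 1)) = ψ (Ideal.Quotient.mk _ (X 1)))
    (h2 : φ (Ideal.Quotient.mk _ (X 2)) = ψ (Ideal.Quotient.mk _ (X 2))) : φ = ψ := by
  apply Ideal.Quotient.algHom_ext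
  apply MvPolynomial.algHom_ext
  intro i
  fin_cases i
  · exact h0
  · exact h1
  · exact h2

lemma aux_gen (K : Type) [Field K] (c : K) (q qb t e : ℕ) [hI : (XIdeal K c q qb t e).IsPrime] :
    IntermediateField.adjoin K
      ({algebraMap (XRing K c q qb t e) (XField K c q qb t e) (Ideal.Quotient.mk _ (X 0)),
        algebraMap (XRing K c q qb t e) (XField K c q qb t e) (Ideal.Quotient.mk _ (X 1)),
        Xz K c q qb t e} : Set (XField K c q qb t e)) = ⊤ := by
  rw [eq_top_iff]
  set E := IntermediateField.adjoin K
      ({algebraMap (XRing K c q qb t e) (XField K c q qb t e) (Ideal.Quotient.mk _ (X 0)),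
        algebraMap (XRing K c q qb t e) (XField K c q qb t e) (Ideal.Quotient.mk _ (X 1)),
        Xz K c q qb t e} : Set (XField K c q qb t e)) with hE
  have key : ∀ r : XRing K c q qb t e, algebraMap _ (XField K c q qb t e) r ∈ E := by
    intro r
    obtain ⟨f, rfl⟩ := Ideal.Quotient.mk_surjective r
    induction f using MvPolynomial.induction_on with
    | C a => exact E.algebraMap_mem a
    | add f g hf hg => rw [map_add, map_add]; exact E.add_mem hf hg
    | mul_X f i hf =>
      rw [map_mul, map_mul]
      refine E.mul_mem hf ?_
      apply IntermediateField.subset_adjoin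
      fin_cases i
      · exact Or.inl rfl
      · exact Or.inr (Or.inl rfl)
      · exact Or.inr (Or.inr rfl)
  intro w _
  obtain ⟨r, s, _, rfl⟩ := IsFractionRing.div_surjective (A := XRing K c q qb t e) w
  exact E.div_mem (key r) (key s)

/-- The endomorphisms of the coordinate ring. -/
lemma aux_endo (K : Type) [Field K] (p b e q t : ℕ) [Fact p.Prime] [CharP K p]
    (hq : q = (p ^ b) ^ e) (c : K) (hc : c ^ q = -c) [hI : (XIdeal K c q (p ^ b) t e).IsPrime]
    (α β : K) (hα : α ^ q ^ 2 = α)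
    (hβ : ∑ i ∈ Finset.range e, β ^ (p ^ b) ^ i = c * α ^ (q + 1)) :
    ∃ φ : XRing K c q (p ^ b) t e →ₐ[K] XRing K c q (p ^ b) t e,
      φ (Ideal.Quotient.mk _ (X 0)) = Ideal.Quotient.mk _ (X 0) +
        (algebraMap K _ (c * α ^ q) * Ideal.Quotient.mk _ (X 1) -
        (algebraMap K _ (c * α ^ q) * Ideal.Quotient.mk _ (X 1)) ^ (p ^ b)) + algebraMap K _ β ∧
      φ (Ideal.Quotient.mk _ (X 1)) = Ideal.Quotient.mk _ (X 1) + algebraMap K _ α ∧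
      φ (Ideal.Quotient.mk _ (X 2)) = Ideal.Quotient.mk _ (X 2) := by
  have : CharP (XRing K c q (p ^ b) t e) p :=
    charP_of_injective_algebraMap (algebraMap K (XRing K c q (p ^ b) t e)).injective p
  apply aux_lift
  · have h1 : (Ideal.Quotient.mk (XIdeal K c q (p ^ b) t e) (X 1) +
        algebraMap K (XRing K c q (p ^ b) t e) α) ^ q ^ 2
        = (Ideal.Quotient.mk (XIdeal K c q (p ^ b) t e) (X 1)) ^ q ^ 2 +
          (algebraMap K (XRing K c q (p ^ b) t e) α) ^ q ^ 2 := by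
      exact aux_addpow p _ ⟨b * (e * 2), by rw [hq, pow_mul, pow_mul]⟩ _ _
    rw [h1, ← map_pow (algebraMap K (XRing K c q (p ^ b) t e)), hα, aux_rel1]
    ring
  · have := aux_key p b e q hq (Ideal.Quotient.mk (XIdeal K c q (p ^ b) t e) (X 0))
      (Ideal.Quotient.mk (XIdeal K c q (p ^ b) t e) (X 1))
      (algebraMap K (XRing K c q (p ^ b) t e) c) (algebraMap K (XRing K c q (p ^ b) t e) α)
      (algebraMap K (XRing K c q (p ^ b) t e) β)
      (by rw [← map_pow, hc, map_neg]) (by rw [← map_pow, hα]) (aux_rel2 _ _ _ _ _ _)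
      (by simp only [← map_pow, ← map_sum, ← map_mul, hβ])
    rw [this]
    simp only [map_mul, map_pow]

lemma aux_endo_inj (K : Type) [Field K] (p b e q t : ℕ) [Fact p.Prime] [CharP K p]
    (hq : q = (p ^ b) ^ e) (c : K) (hc : c ^ q = -c) [hI : (XIdeal K c q (p ^ b) t e).IsPrime]
    (α β : K) (hα : α ^ q ^ 2 = α)
    (hβ : ∑ i ∈ Finset.range e, β ^ (p ^ b) ^ i = c * α ^ (q + 1)) :
    ∃ φ : XRing K c q (p ^ b) t e →ₐ[K] XRing K c q (p ^ b) t e,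
      Function.Injective φ ∧
      φ (Ideal.Quotient.mk _ (X 0)) = Ideal.Quotient.mk _ (X 0) +
        (algebraMap K _ (c * α ^ q) * Ideal.Quotient.mk _ (X 1) -
        (algebraMap K _ (c * α ^ q) * Ideal.Quotient.mk _ (X 1)) ^ (p ^ b)) + algebraMap K _ β ∧
      φ (Ideal.Quotient.mk _ (X 1)) = Ideal.Quotient.mk _ (X 1) + algebraMap K _ α ∧
      φ (Ideal.Quotient.mk _ (X 2)) = Ideal.Quotient.mk _ (X 2) := by
  have : CharP (XRing K c q (p ^ b) t e) p :=
    charP_of_injective_algebraMap (algebraMap K (XRing K c q (p ^ b) t e)).injective p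
  obtain ⟨φ, h0, h1, h2⟩ := aux_endo K p b e q t hq c hc α β hα hβ
  have hneg : ∀ (k : ℕ) (u : K), (-u) ^ (p ^ k) = - u ^ (p ^ k) := by
    intro k u
    exact aux_negpow p k u
  have hnq : ∀ u : K, (-u) ^ q = - u ^ q := by
    intro u; rw [hq, ← pow_mul]; exact hneg _ u
  set v : K := c * α ^ (q + 1) with hv
  have hvq : v ^ q = -v := by
    have h2 : (α ^ q) ^ q = α := by rw [← pow_mul, ← sq, hα]
    rw [hv, mul_pow, pow_succ, mul_pow, h2, hc]; ring
  obtain ⟨ψ, k0, k1, k2⟩ := aux_endo K p b e q t hq c hc (-α) (-β + (v - v ^ (p ^ b)))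
    (by rw [hq, ← pow_mul, ← pow_mul, hneg, pow_mul, pow_mul, ← hq, hα])
    (by
      rw [aux_tr_add, aux_tr_sub, ← hq, hvq]
      have : ∑ i ∈ Finset.range e, (-β) ^ (p ^ b) ^ i = -v := by
        rw [← hβ, ← Finset.sum_neg_distrib]
        refine Finset.sum_congr rfl fun i _ => ?_
        rw [← pow_mul, hneg]
      rw [this, pow_succ (-α), hnq, hv]; ring)
  refine ⟨φ, ?_, h0, h1, h2⟩
  have hid : ψ.comp φ = AlgHom.id K _ := by
    apply aux_ext
    · simp only [AlgHom.comp_apply, AlgHom.id_apply, h0, map_add, map_sub, map_mul, map_pow,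
        AlgHom.commutes, k0, k1, hnq, map_neg]
      have hs : ∀ u w : XRing K c q (p ^ b) t e, (u - w) ^ (p ^ b) = u ^ (p ^ b) - w ^ (p ^ b) :=
        fun u w => aux_subpow p b u w
      have hn : ∀ w : XRing K c q (p ^ b) t e, (-w) ^ (p ^ b) = - w ^ (p ^ b) := by
        intro w
        exact aux_negpow p b w
      simp only [← sub_eq_add_neg, mul_sub, hs, hv, map_mul, map_pow, pow_succ, mul_assoc]
      linear_combination (-((algebraMap K (XRing K c q (p ^ b) t e)) c ^ p ^ b *
        (algebraMap K (XRing K c q (p ^ b) t e)) α ^ (q * p ^ b) *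
        (Ideal.Quotient.mk (XIdeal K c q (p ^ b) t e)) (X 1) ^ p ^ b)) * hn 1
    · simp [h1, k1]
    · simp [h2, k2]
  intro u w huw
  have := congrArg ψ huw
  rwa [← AlgHom.comp_apply, ← AlgHom.comp_apply, hid] at this


set_option synthInstance.maxHeartbeats 1000000 in
set_option maxHeartbeats 2000000 in
lemma aux_main (K : Type) [Field K] [IsAlgClosed K] (p b e q t : ℕ) [Fact p.Prime] [CharP K p]
    (hb : 0 < b) (hq : q = (p ^ b) ^ (e + 1)) (hq1 : 1 < q) (hqb1 : 1 < p ^ b)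
    (c : K) (hc : c ^ q = -c) [hI : (XIdeal K c q (p ^ b) t (e + 1)).IsPrime] :
    IsGalois (IntermediateField.adjoin K ({Xz K c q (p ^ b) t (e + 1)} :
        Set (XField K c q (p ^ b) t (e + 1)))) (XField K c q (p ^ b) t (e + 1)) ∧
    Module.finrank (IntermediateField.adjoin K ({Xz K c q (p ^ b) t (e + 1)} :
        Set (XField K c q (p ^ b) t (e + 1)))) (XField K c q (p ^ b) t (e + 1))
      = q ^ 2 * (p ^ b) ^ e := by
  have hup := aux_upper _ _ _ (aux_gen K c q (p ^ b) t (e + 1)) c (q ^ 2) q t e (p ^ b)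
    (Nat.one_lt_pow (by omega) hq1) hqb1
    (by
      rw [Xz, ← map_pow, aux_rel1, map_sub, map_pow])
    (by
      simp only [← map_pow, ← map_sum]
      rw [IsScalarTower.algebraMap_apply K (XRing K c q (p ^ b) t (e + 1)), ← map_mul]
      congr 1
      simp only [map_pow, map_sum]
      exact aux_rel2 K c q (p ^ b) t (e + 1))
  have hfd := hup.1
  have hend := fun i : (Σ α : {α : K // α ^ q ^ 2 = α},
      {β : K // ∑ i ∈ Finset.range (e + 1), β ^ (p ^ b) ^ i = c * α.1 ^ (q + 1)}) =>
    aux_endo_inj K p b (e + 1) q t hq c hc i.1.1 i.2.1 i.1.2 i.2.2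
  choose φ hφi h0 h1 h2 using hend
  have hext : ∀ i, ∃ Φ : XField K c q (p ^ b) t (e + 1) →ₐ[IntermediateField.adjoin K
      ({Xz K c q (p ^ b) t (e + 1)} : Set (XField K c q (p ^ b) t (e + 1)))]
      XField K c q (p ^ b) t (e + 1), ∀ r : XRing K c q (p ^ b) t (e + 1),
        Φ (algebraMap _ _ r) = algebraMap _ _ (φ i r) := by
    intro i
    let g : XRing K c q (p ^ b) t (e + 1) →ₐ[K] XField K c q (p ^ b) t (e + 1) :=
      (IsScalarTower.toAlgHom K (XRing K c q (p ^ b) t (e + 1)) (XField K c q (p ^ b) t (e + 1))).comp (φ i)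
    have hg : Function.Injective g := (IsFractionRing.injective (XRing K c q (p ^ b) t (e + 1))
      (XField K c q (p ^ b) t (e + 1))).comp (hφi i)
    let G : XField K c q (p ^ b) t (e + 1) →ₐ[K] XField K c q (p ^ b) t (e + 1) :=
      IsFractionRing.liftAlgHom (g := g) hg
    have hG : ∀ r : XRing K c q (p ^ b) t (e + 1), G (algebraMap _ _ r) = algebraMap _ _ (φ i r) := by
      intro r
      exact IsFractionRing.lift_algebraMap hg r
    have hfix : ∀ w ∈ IntermediateField.adjoin K
      ({Xz K c q (p ^ b) t (e + 1)} : Set (XField K c q (p ^ b) t (e + 1))), G w = w := by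
      intro w hw
      induction hw using IntermediateField.adjoin_induction with
      | mem u hu =>
        rw [Set.mem_singleton_iff] at hu
        rw [hu, Xz, hG, h2]
      | algebraMap u => exact G.commutes u
      | add u v _ _ hu hv => rw [map_add, hu, hv]
      | inv u _ hu => rw [map_inv₀, hu]
      | mul u v _ _ hu hv => rw [map_mul, hu, hv]
    exact ⟨{ G with commutes' := fun r => hfix r.1 r.2 }, hG⟩
  choose Φ hΦ using hext
  refine aux_galois _ hup.2 (aux_count p b e q hb hq c) Φ ?_
  have hinjK : Function.Injective (algebraMap K (XRing K c q (p ^ b) t (e + 1))) :=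
    (algebraMap K (XRing K c q (p ^ b) t (e + 1))).injective
  have hinjA := IsFractionRing.injective (XRing K c q (p ^ b) t (e + 1))
      (XField K c q (p ^ b) t (e + 1))
  intro i j hij
  have hr : ∀ r, φ i r = φ j r := by
    intro r
    apply hinjA
    rw [← hΦ, ← hΦ, hij]
  have e1 := hr (Ideal.Quotient.mk _ (X 1))
  rw [h1, h1] at e1
  have e1' := hinjK (add_left_cancel e1)
  have e0 := hr (Ideal.Quotient.mk _ (X 0))
  rw [h0, h0] at e0
  clear hr hij e1
  obtain ⟨⟨α, hα⟩, ⟨β, hβ⟩⟩ := i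
  obtain ⟨⟨α', hα'⟩, ⟨β', hβ'⟩⟩ := j
  simp only at e1' e0
  subst e1'
  have e0' := hinjK (add_left_cancel e0)
  subst e0'
  rfl

set_option synthInstance.maxHeartbeats 1000000 in
set_option maxHeartbeats 2000000 in
/-- Theorem: the field extension `F'/K(z)` is Galois of degree `q^3/q̄`. -/
theorem stmt11 (p a b q qb n m s : ℕ) (hp : p.Prime) (ha : 0 < a) (hq : q = p ^ a)
    (hb : 0 < b) (hba : b ∣ a) (hqb : qb = p ^ b)
    (hn : 3 ≤ n) (hodd : Odd n) (hm : m * (q + 1) = q ^ n + 1)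
    (hs : s ∣ m) (hs0 : 0 < s)
    (K : Type) [Field K] [IsAlgClosed K] [CharP K p]
    (c : K) (hc2 : c ^ q ^ 2 = c) (hc : c ^ (q - 1) = -1)
    [hI : (XIdeal K c q qb (m / s) (a / b)).IsPrime] :
    IsGalois (IntermediateField.adjoin K ({Xz K c q qb (m / s) (a / b)} :
        Set (XField K c q qb (m / s) (a / b)))) (XField K c q qb (m / s) (a / b)) ∧
    Module.finrank (IntermediateField.adjoin K ({Xz K c q qb (m / s) (a / b)} :
        Set (XField K c q qb (m / s) (a / b)))) (XField K c q qb (m / s) (a / b))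
      = q ^ 3 / qb := by
  obtain ⟨e', rfl⟩ := hba
  have he' : 0 < e' := Nat.pos_of_mul_pos_left ha
  obtain ⟨e, rfl⟩ : ∃ e, e' = e + 1 := ⟨e' - 1, by omega⟩
  revert hI
  rw [Nat.mul_div_cancel_left _ hb]
  have hpf : Fact p.Prime := ⟨hp⟩
  subst hqb
  generalize m / s = t
  intro hI
  have hq' : q = (p ^ b) ^ (e + 1) := by rw [hq, pow_mul]
  have hqb1 : 1 < p ^ b := Nat.one_lt_pow hb.ne' hp.one_lt
  have hq1 : 1 < q := by rw [hq']; exact Nat.one_lt_pow (by omega) hqb1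
  have hcq : c ^ q = -c := by
    obtain ⟨r, rfl⟩ : ∃ r, q = r + 1 := ⟨q - 1, by omega⟩
    rw [Nat.add_sub_cancel] at hc
    rw [pow_succ, hc]; ring
  have hdeg : q ^ 3 / p ^ b = q ^ 2 * (p ^ b) ^ e := by
    apply Nat.div_eq_of_eq_mul_left (by omega)
    rw [mul_assoc, ← pow_succ, ← hq']; ring
  rw [hdeg]
  exact aux_main K p b e q t hb hq' hq1 hqb1 c hcq
end
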